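/- Let (Q,+) be a loop and A : Q → Q a mapping such that (x+A(x))+(y+z) = (x+y)+(A(x)+z) for all x,y,z ∈ Q. Then (Q,+) is a Moufang loop, A(x) ∈ K(Q) and -x+A(x) ∈ N(Q) for all x, and consequently Q = N(Q)+K(Q) (Q is an NK-loop). -/

import Mathlib

universe u

class Loop (Q : Type u) extends Add Q, Zero Q where
  addLeft_bijective : ∀ a : Q, Function.Bijective (fun x => a + x)
  addRight_bijective : ∀ a : Q, Function.Bijective (fun x => x + a)
  zero_add : ∀ a : Q, 0 + a = a
  add_zero : ∀ a : Q, a + 0 = a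

/-- The commutant `C(Q)` of a loop. -/
def commutant (Q : Type u) [Loop Q] : Set Q := {a | ∀ x, a + x = x + a}

/-- The Moufang center `K(Q)` of a loop. -/
def moufangCenter (Q : Type u) [Loop Q] : Set Q :=
  {a | ∀ x y, (a + a) + (x + y) = (a + x) + (a + y)}

/-- The nucleus `N(Q)` of a loop. -/
def nucleus (Q : Type u) [Loop Q] : Set Q :=
  {a | ∀ x y, ((a + x) + y = a + (x + y)) ∧ ((x + a) + y = x + (a + y)) ∧
    ((x + y) + a = x + (y + a))}

/-- The Moufang identity. -/
def IsMoufang (Q : Type u) [Loop Q] : Prop :=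
  ∀ x y z : Q, x + (y + (x + z)) = ((x + y) + x) + z

namespace Loop

section basic

variable {Q : Type u} [Loop Q]

theorem left_cancel {a x y : Q} (h : a + x = a + y) : x = y :=
  (addLeft_bijective a).1 h

theorem right_cancel {a x y : Q} (h : x + a = y + a) : x = y :=
  (addRight_bijective a).1 h

theorem exists_add_left (a b : Q) : ∃ x, a + x = b :=
  (addLeft_bijective a).2 b

/-- The triple `(L_a, L_b, L_a L_b)` of left translations is an autotopism. -/
def MedialPair (a b : Q) : Prop :=
  ∀ y z : Q, a + (b + (y + z)) = (a + y) + (b + z)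

namespace MedialPair

variable {x f g h : Q}

theorem assoc (H : MedialPair x f) (z : Q) : (x + f) + z = x + (f + z) := by
  obtain ⟨t, rfl⟩ := exists_add_left f z
  exact (H f t).symm

theorem add_right (H : MedialPair x f) (y : Q) : (x + y) + f = x + (f + y) := by
  have := H y 0
  rw [add_zero, add_zero] at this
  exact this.symm

theorem add (H₁ : MedialPair x f) (H₂ : MedialPair f g) : MedialPair (x + f) (f + g) := by
  intro y z
  rw [H₁.assoc, H₂.assoc, H₂.assoc, H₁.assoc, ← H₁, ← H₂]

theorem add_neg_right (H : MedialPair x f) {f' : Q} (hf : f + f' = 0) (y : Q) :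
    f + (y + f') = y := by
  have := H y f'
  rw [hf, add_zero] at this
  exact left_cancel this

theorem comm (H : MedialPair x f) : f + x = x + f := by
  obtain ⟨f', hf⟩ := exists_add_left f 0
  have h1 := H.add_neg_right hf (x + f)
  rwa [H.assoc, hf, add_zero] at h1

theorem neg_add (H : MedialPair x f) {x' : Q} (hx : x + x' = 0) : x' + x = 0 := by
  have h1 := H x' x
  rw [hx, zero_add, H.comm] at h1
  exact left_cancel (left_cancel (h1.trans (by rw [add_zero])))

theorem comm_translations (H₁ : MedialPair x f) (H₂ : MedialPair f g) (w : Q) :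
    f + ((x + w) + g) = x + (f + (w + g)) ∧
      ∀ u y, (u + f) + (y + g) = f + ((u + y) + g) := by
  have key : ∀ v t, ((x + v) + f) + ((f + t) + g) = x + (f + ((f + (v + t)) + g)) ∧
      (x + v) + (f + t) = x + (f + (v + t)) := by
    intro v t
    rw [H₁.add_right, H₂.add_right, H₂.add_right, ← H₁, ← H₂, ← H₁]
    exact ⟨rfl, rfl⟩
  have swap : ∀ w, f + ((x + w) + g) = x + (f + (w + g)) := by
    intro w
    obtain ⟨v, hv⟩ := exists_add_left x 0
    obtain ⟨r, rfl⟩ := exists_add_left f w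
    obtain ⟨t, rfl⟩ := exists_add_left v r
    have := key v t
    rw [hv, zero_add, zero_add] at this
    rw [← this.1, this.2]
  refine ⟨swap w, fun u y => ?_⟩
  obtain ⟨v, rfl⟩ := exists_add_left x u
  obtain ⟨t, rfl⟩ := exists_add_left f y
  rw [(key v t).1, (key v t).2, swap]

theorem exists_conj (H₁ : MedialPair x f) (H₂ : MedialPair f g) :
    ∃ θ : Q → Q, (∀ a b, θ (a + b) = θ a + θ b) ∧ (∀ y, y + f = f + θ y) ∧
      (∀ y, y + g = g + θ y) := by
  choose θ hθ using fun y => exists_add_left f (y + f)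
  choose θ' hθ' using fun y => exists_add_left g (y + g)
  have key : ∀ u y, θ u + θ' y = θ' (u + y) := by
    intro u y
    have := (comm_translations H₁ H₂ 0).2 u y
    rw [← hθ, ← hθ', ← hθ', ← H₂] at this
    exact left_cancel (left_cancel this)
  have h0 : θ 0 = 0 := left_cancel (a := f) (by rw [hθ, zero_add, add_zero])
  have h0' : θ' 0 = 0 := left_cancel (a := g) (by rw [hθ', zero_add, add_zero])
  have heq : ∀ u, θ u = θ' u := fun u => by simpa [h0', add_zero] using key u 0
  refine ⟨θ, fun a b => ?_, fun y => (hθ y).symm, fun y => ?_⟩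
  · rw [heq (a + b), heq b, key]
  · rw [heq, hθ']

theorem exists_conj_chain (H₁ : MedialPair x f) (H₂ : MedialPair f g) (H₃ : MedialPair g h) :
    ∃ θ : Q → Q, (∀ a b, θ (a + b) = θ a + θ b) ∧ (∀ y, y + f = f + θ y) ∧
      (∀ y, y + g = g + θ y) ∧ (∀ y, y + h = h + θ y) := by
  obtain ⟨θ, hθ, h1, h2⟩ := exists_conj H₁ H₂
  obtain ⟨θ', -, h3, h4⟩ := exists_conj H₂ H₃
  refine ⟨θ, hθ, h1, h2, fun y => ?_⟩
  rw [h4, left_cancel ((h3 y).symm.trans (h2 y))]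

end MedialPair

/-- `α` is the commutator of the left translations by `f` and `v`. -/
def IsCommutator (f v : Q) (α : Q → Q) : Prop :=
  ∀ z, f + α (v + z) = v + (f + z)

theorem exists_isCommutator (f v : Q) : ∃ α : Q → Q, IsCommutator f v α := by
  choose r hr using exists_add_left v
  choose α hα using fun z => exists_add_left f (v + (f + r z))
  refine ⟨α, fun z => ?_⟩
  rw [hα, left_cancel (hr (v + z))]

namespace IsCommutator

variable {x f g h y v w : Q} {α β γ : Q → Q}

theorem map_zero (hα : IsCommutator f v α) (Hv : MedialPair y v) : α 0 = 0 := by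
  obtain ⟨v', hv⟩ := exists_add_left v 0
  have := hα v'
  rw [hv, Hv.add_neg_right hv] at this
  exact left_cancel (this.trans (add_zero f).symm)

theorem add_assoc (hα : IsCommutator f v α) (Hv : MedialPair y v) (z : Q) :
    (y + f) + z = y + (f + α z) := by
  obtain ⟨t, rfl⟩ := exists_add_left v z
  rw [hα, ← Hv]

theorem eq_and_map_add (hα : IsCommutator f v α) (hβ : IsCommutator g w β)
    (Hf : MedialPair f g) (Hv : MedialPair y v) (Hw : MedialPair v w) :
    β = α ∧ ∀ a b, α (a + b) = α a + α b := by
  have expand : ∀ a b, f + (g + (α (v + a) + β (w + b))) = v + (w + (f + (g + (a + b)))) := by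
    intro a b
    rw [Hf, hα, hβ, ← Hw, ← Hf]
  have dep : ∀ p q p' q', p + q = p' + q' → α p + β q = α p' + β q' := by
    intro p q p' q' hpq
    obtain ⟨a, rfl⟩ := exists_add_left v p
    obtain ⟨b, rfl⟩ := exists_add_left w q
    obtain ⟨a', rfl⟩ := exists_add_left v p'
    obtain ⟨b', rfl⟩ := exists_add_left w q'
    rw [← Hw, ← Hw] at hpq
    refine left_cancel (a := g) (left_cancel (a := f) ?_)
    rw [expand, expand, left_cancel (left_cancel hpq)]
  have hα0 := hα.map_zero Hv
  have hβ0 := hβ.map_zero Hw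
  have heq : ∀ p, β p = α p := by
    intro p
    have := dep 0 p p 0 (by rw [zero_add, add_zero])
    rwa [hα0, hβ0, zero_add, add_zero] at this
  refine ⟨funext heq, fun a b => ?_⟩
  have := dep a b (a + b) 0 (by rw [add_zero])
  rw [hβ0, add_zero, heq] at this
  exact this.symm

theorem add_apply (hα : IsCommutator f v α) (hβ : IsCommutator g v β)
    (hγ : IsCommutator (f + g) v γ) (Hf : MedialPair f g) (u : Q) :
    g + γ u = α (g + β u) := by
  obtain ⟨z, rfl⟩ := exists_add_left v u
  have := hγ z
  rw [Hf.assoc, Hf.assoc, ← hα, ← hβ] at this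
  exact left_cancel this

theorem map_right (hα : IsCommutator f v α) (Hf : MedialPair f g) (Hv : MedialPair y v) :
    α g = g := by
  obtain ⟨β, hβ⟩ := exists_isCommutator g v
  obtain ⟨γ, hγ⟩ := exists_isCommutator (f + g) v
  have := hα.add_apply hβ hγ Hf 0
  rw [hγ.map_zero Hv, hβ.map_zero Hv, add_zero] at this
  exact this.symm

end IsCommutator

/-- The element `f` commutes with all elements. -/
theorem comm_of_medialPair (A : Q → Q) (hA : ∀ x, MedialPair x (A x)) {x f : Q}
    (H₁ : MedialPair x f) (y : Q) : y + f = f + y := by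
  have H₂ := hA f
  set g := A f
  have H₃ := hA g
  set h := A g
  obtain ⟨θ, hθ, hf, hg, hh⟩ := H₁.exists_conj_chain H₂ H₃
  have hθf : θ f = f := (left_cancel (hf f)).symm
  have hθg : θ g = g := (left_cancel (hg g)).symm
  have hθh : θ h = h := (left_cancel (hh h)).symm
  have hinj : ∀ {a b}, θ a = θ b → a = b := by
    intro a b hab
    refine right_cancel (a := f) ?_
    rw [hf, hf, hab]
  have hsurj : ∀ a, ∃ b, θ b = a := by
    intro a
    obtain ⟨b, hb⟩ := (addRight_bijective f).2 (f + a)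
    exact ⟨b, left_cancel ((hf b).symm.trans hb)⟩
  have swap_fg : ∀ y, f + (g + y) = g + (f + θ y) := by
    intro y
    rw [← H₂.add_right, hg, hθ, hθf]
  have swap_gh : ∀ y, g + (h + y) = h + (g + θ y) := by
    intro y
    rw [← H₃.add_right, hh, hθ, hθg]
  have swap_f_gh : ∀ y, g + (h + (f + y)) = f + (g + (h + y)) := by
    intro y
    obtain ⟨w, rfl⟩ := hsurj y
    have := (MedialPair.comm_translations H₂ H₃ w).1
    rwa [hh, hh, hθ, hθf] at this
  have add_gh : ∀ z, z + (g + h) = g + (h + θ z) := by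
    intro z
    obtain ⟨u, rfl⟩ := exists_add_left (f + g) z
    rw [(H₂.add H₃).add_right, H₂.assoc, H₃.assoc, H₂.assoc, hθ, hθ, hθf, hθg,
      swap_f_gh, ← swap_gh]
  obtain ⟨α, hα⟩ := exists_isCommutator f (A y)
  obtain ⟨α', hα'⟩ := exists_isCommutator g (A (A y))
  obtain ⟨β, hβ⟩ := exists_isCommutator g (A y)
  obtain ⟨β', hβ'⟩ := exists_isCommutator h (A (A y))
  obtain ⟨γ, hγ⟩ := exists_isCommutator (f + g) (A y)
  obtain ⟨γ', hγ'⟩ := exists_isCommutator (g + h) (A (A y))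
  obtain ⟨rfl, α_add⟩ := hα.eq_and_map_add hα' H₂ (hA y) (hA _)
  obtain ⟨-, β_add⟩ := hβ.eq_and_map_add hβ' H₃ (hA y) (hA _)
  obtain ⟨-, γ_add⟩ := hγ.eq_and_map_add hγ' (H₂.add H₃) (hA y) (hA _)
  have hαg := hα.map_right H₂ (hA y)
  have hαh := hα'.map_right H₃ (hA _)
  have hβh := hβ.map_right H₃ (hA y)
  have hγgh := hγ.map_right (H₂.add H₃) (hA y)
  have hγ_eq : ∀ u, γ u = α' (β u) := by
    intro u
    have := hα.add_apply hβ hγ H₂ u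
    rw [α_add, hαg] at this
    exact left_cancel this
  have α_θ : ∀ z, α' (θ z) = θ (α' z) := by
    intro z
    have := congrArg α' (hg z)
    rw [α_add, α_add, hαg, hg] at this
    exact (left_cancel this).symm
  have β_θ : ∀ z, β (θ z) = θ (β z) := by
    intro z
    have := congrArg β (hh z)
    rw [β_add, β_add, hβh, hh] at this
    exact (left_cancel this).symm
  have push_fg : ∀ z, y + (f + (g + θ (α' z))) = f + (g + θ (y + z)) := by
    intro z
    have := (MedialPair.comm_translations H₁ H₂ 0).2 y z
    rwa [hα.add_assoc (hA y), α_add, hαg, hg, hg] at this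
  have push_gh : ∀ z, y + (g + (h + θ (β z))) = g + (h + θ (y + z)) := by
    intro z
    have := (MedialPair.comm_translations H₂ H₃ 0).2 y z
    rwa [hβ.add_assoc (hA y), β_add, hβh, hh, hh] at this
  have push_fg_gh : ∀ z, y + (f + (g + (g + (h + θ (γ z))))) =
      f + (g + (g + (h + θ (y + z)))) := by
    intro z
    have := (MedialPair.comm_translations (H₁.add H₂) (H₂.add H₃) 0).2 y z
    rwa [hγ.add_assoc (hA y), γ_add, hγgh, add_gh, add_gh, H₂.assoc, H₂.assoc] at this
  have key : θ (y + 0) = y + θ 0 := by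
    have h1 := push_fg (g + (h + θ (β 0)))
    rw [push_gh, hθ, hθ, hθg, hθh, α_add, α_add, hαg, hαh, hθ, hθ, hθg, hθh, α_θ, ← α_θ, ← β_θ,
      ← hγ_eq, push_fg_gh] at h1
    exact (hinj (left_cancel (left_cancel (left_cancel (left_cancel h1))))).symm
  rw [hθ] at key
  rw [hf, right_cancel key]

theorem MedialPair.add_left_comm {x f : Q} (H : MedialPair x f) (c : ∀ y, y + f = f + y) (z : Q) :
    x + (f + z) = f + (x + z) := by
  rw [← H.add_right, c]

end basic

section inverses

variable {Q : Type u} [Loop Q] {A neg : Q → Q} (hA : ∀ x, MedialPair x (A x))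
  (hneg : ∀ x : Q, x + neg x = 0)

include hA hneg

theorem add_neg_cancel_left (x z : Q) : x + (neg x + z) = z := by
  have := hA x (neg x) z
  rw [hneg, zero_add, (hA x).add_left_comm (comm_of_medialPair A hA (hA x))] at this
  exact left_cancel this

theorem neg_neg (x : Q) : neg (neg x) = x :=
  left_cancel ((hneg _).trans ((hA x).neg_add (hneg x)).symm)

theorem neg_add_cancel_left (x z : Q) : neg x + (x + z) = z := by
  simpa only [neg_neg hA hneg] using add_neg_cancel_left hA hneg (neg x) z

theorem eq_neg_add {x y z : Q} (h : x + y = z) : y = neg x + z := by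
  rw [← h, neg_add_cancel_left hA hneg]

variable {x f : Q} (H : MedialPair x f)

include H

theorem add_neg_add (y : Q) : f + neg (f + y) = neg y := by
  have H₂ := hA f
  have h1 := eq_neg_add hA hneg (H₂ y (neg y)).symm
  rw [hneg, add_zero, comm_of_medialPair A hA (H.add H₂), H₂.assoc,
    H₂.add_left_comm (comm_of_medialPair A hA H₂)] at h1
  exact (left_cancel h1).symm

theorem add_add_add_swap (y t : Q) : y + (f + (A f + t)) = A f + ((f + y) + t) := by
  have := hA f (neg (f + y)) ((f + y) + t)
  rw [neg_add_cancel_left hA hneg, add_neg_add hA hneg H] at this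
  rw [this, add_neg_cancel_left hA hneg]

theorem add_self_add (y u : Q) : (f + (f + y)) + u = f + (y + (f + u)) := by
  obtain ⟨t, rfl⟩ := exists_add_left (A f) u
  have sw := (hA f).add_left_comm (comm_of_medialPair A hA (hA f))
  rw [add_add_add_swap hA hneg H, ← hA f, sw]

omit H

theorem neg_add_add_cancel (x y : Q) : neg (x + y) + x = neg y := by
  have H := hA x
  set f := A x
  have sw := H.add_left_comm (comm_of_medialPair A hA H)
  have h1 := eq_neg_add hA hneg (H (f + (f + y)) (neg (f + (f + y)))).symm
  rw [hneg, add_zero, ← H.comm, sw, sw] at h1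
  have h2 := add_self_add hA hneg H (neg (f + (f + (x + y)))) x
  rwa [← h1, add_neg_add hA hneg H, add_neg_add hA hneg H, add_neg_add hA hneg H,
    add_neg_add hA hneg H] at h2

theorem add_add_neg_cancel (x y : Q) : (x + y) + neg y = x := by
  rw [← neg_add_add_cancel hA hneg x y, add_neg_cancel_left hA hneg]

theorem add_neg_add_cancel (x y : Q) : (x + neg y) + y = x := by
  simpa only [neg_neg hA hneg] using add_add_neg_cancel hA hneg x (neg y)

theorem neg_add_rev (x y : Q) : neg (x + y) = neg y + neg x := by
  rw [← neg_add_add_cancel hA hneg x y, add_add_neg_cancel hA hneg]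

/-- A left nuclear element lies in the nucleus. -/
theorem mem_nucleus_of_left {c : Q} (hc : ∀ x y, (c + x) + y = c + (x + y)) : c ∈ nucleus Q := by
  have hc' : ∀ x y, (neg c + x) + y = neg c + (x + y) := by
    intro x y
    refine left_cancel (a := c) ?_
    rw [← hc, add_neg_cancel_left hA hneg, add_neg_cancel_left hA hneg]
  have right : ∀ d, (∀ x y, (neg d + x) + y = neg d + (x + y)) →
      ∀ x y, (x + y) + d = x + (y + d) := by
    intro d hd x y
    have := congrArg neg (hd (neg y) (neg x))
    simp only [neg_add_rev hA hneg, neg_neg hA hneg] at this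
    exact this.symm
  refine fun x y => ⟨hc x y, ?_, right c hc' x y⟩
  have h1 := add_add_neg_cancel hA hneg x (c + y)
  rw [neg_add_rev hA hneg,
    ← right (neg c) (by simpa only [neg_neg hA hneg] using hc)] at h1
  have h2 := add_neg_add_cancel hA hneg (x + (c + y)) y
  rwa [right_cancel (h1.trans (add_add_neg_cancel hA hneg x c).symm)] at h2

theorem neg_mem_nucleus {c : Q} (hc : c ∈ nucleus Q) : neg c ∈ nucleus Q := by
  refine mem_nucleus_of_left hA hneg fun x y => left_cancel (a := c) ?_
  rw [← (hc _ _).1, add_neg_cancel_left hA hneg, add_neg_cancel_left hA hneg]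

include H

theorem add_add_comm (p r : Q) : f + (p + (A f + r)) = A f + (p + (f + r)) := by
  have H₂ := hA f
  set g := A f
  have sw := H₂.add_left_comm (comm_of_medialPair A hA H₂)
  have assoc : ∀ p r, (f + (g + p)) + r = f + (p + (g + r)) := by
    intro p r
    have := H₂ (p + (g + r)) (neg (g + r))
    rw [add_add_neg_cancel hA hneg, add_neg_add hA hneg H₂] at this
    rw [this, add_neg_add_cancel hA hneg]
  have swap : ∀ y t, y + (f + (g + t)) = f + ((g + y) + t) := by
    intro y t
    obtain ⟨p, rfl⟩ := exists_add_left g y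
    rw [add_add_add_swap hA hneg H, assoc, add_self_add hA hneg H₂, sw]
  obtain ⟨t, rfl⟩ := exists_add_left g r
  rw [swap, ← sw, ← assoc, ← H₂]

theorem add_add_add_distrib (x y : Q) : f + (f + (x + y)) = (f + x) + (f + y) := by
  have H₂ := hA f
  have sw := H₂.add_left_comm (comm_of_medialPair A hA H₂)
  refine left_cancel (a := A f) ?_
  rw [← add_add_comm hA hneg H (f + x), ← H₂, sw, sw]

theorem mem_moufangCenter : f ∈ moufangCenter Q := by
  intro x y
  have := add_self_add hA hneg H 0 (x + y)
  rw [add_zero, zero_add] at this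
  rw [this, add_add_add_distrib hA hneg H]

theorem neg_add_mem_nucleus : neg x + f ∈ nucleus Q := by
  have hc : ∀ z, (neg x + f) + z = f + (neg x + z) := by
    intro z
    obtain ⟨b, rfl⟩ := exists_add_left f z
    have sw : neg x + (f + b) = f + (neg x + b) := by
      refine left_cancel (a := x) ?_
      rw [H.add_left_comm (comm_of_medialPair A hA H), add_neg_cancel_left hA hneg,
        add_neg_cancel_left hA hneg]
    rw [sw, add_add_add_distrib hA hneg H, comm_of_medialPair A hA H]
  refine mem_nucleus_of_left hA hneg fun y z => ?_
  obtain ⟨q, rfl⟩ := exists_add_left x y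
  obtain ⟨w, rfl⟩ := exists_add_left f z
  rw [← H, hc, hc, neg_add_cancel_left hA hneg, neg_add_cancel_left hA hneg,
    add_add_add_distrib hA hneg H]

theorem exists_mem_nucleus_eq_add : ∃ n ∈ nucleus Q, x = n + f := by
  refine ⟨_, neg_mem_nucleus hA hneg (neg_add_mem_nucleus hA hneg H), eq_neg_add hA hneg ?_⟩
  rw [comm_of_medialPair A hA H, add_neg_add_cancel hA hneg]

omit H

theorem isMoufang : IsMoufang Q := by
  intro x y z
  obtain ⟨n, hn, hx⟩ := exists_mem_nucleus_eq_add hA hneg (hA x)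
  have hK := add_self_add hA hneg (hA x)
  have hf := comm_of_medialPair A hA (hA x)
  generalize A x = f at hx hK hf
  subst hx
  rw [(hn f _).1, (hn f _).1, (hn f y).1, (hn _ _).1, (hn _ z).1, ← (hn (f + y) f).2.1,
    (hn f y).2.2, hf, hK, (hn y _).2.1]

end inverses

end Loop

theorem NK_char_forward (Q : Type u) [Loop Q]
    (neg : Q → Q) (hneg : ∀ x : Q, x + neg x = 0)
    (A : Q → Q)
    (h : ∀ x y z : Q, (x + A x) + (y + z) = (x + y) + (A x + z)) :
    IsMoufang Q ∧ (∀ x : Q, A x ∈ moufangCenter Q) ∧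
      (∀ x : Q, neg x + A x ∈ nucleus Q) ∧
      (∀ a : Q, ∃ n ∈ nucleus Q, ∃ k ∈ moufangCenter Q, a = n + k) := by
  have hA : ∀ x, Loop.MedialPair x (A x) := by
    intro x y z
    have := h x 0 (y + z)
    rw [Loop.zero_add, Loop.add_zero] at this
    rw [← this, h]
  refine ⟨Loop.isMoufang hA hneg, fun x => Loop.mem_moufangCenter hA hneg (hA x),
    fun x => Loop.neg_add_mem_nucleus hA hneg (hA x), fun a => ?_⟩
  obtain ⟨n, hn, ha⟩ := Loop.exists_mem_nucleus_eq_add hA hneg (hA a)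
  exact ⟨n, hn, A a, Loop.mem_moufangCenter hA hneg (hA a), ha⟩
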